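/- Let 0 ≤ γ₁ ≤ γ₂ ≤ π and define γ : (0, 1) → [0, π] by: γ(s) = γ₁ if s ∈ (2·4^{−n}, 4·4^{−n}) for some integer n ≥ 1, γ(s) = γ₂ if s ∈ (4^{−n}, 2·4^{−n}) for some integer n ≥ 1, γ(4·4^{−n}) = π and γ(2·4^{−n}) = 0 for every integer n ≥ 1. Then for every x ∈ (0, 1), (1/3)·cos(γ₁) + (2/3)·cos(γ₂) ≤ (1/x) ∫₀^{x} cos(γ(t)) dt ≤ (2/3)·cos(γ₁) + (1/3)·cos(γ₂). -/

import Mathlib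

open Real Set Filter MeasureTheory Topology
open scoped Classical

/-- The contact angle of Example 2: `π` at the points `4·4^{−n}`, `0` at the points
`2·4^{−n}`, `γ₁` on each open interval `(2·4^{−n}, 4·4^{−n})`, and `γ₂` elsewhere
(in particular on each open interval `(4^{−n}, 2·4^{−n})`), for `n = 1, 2, 3, …`. -/
noncomputable def gammaEx2 (γ₁ γ₂ : ℝ) (s : ℝ) : ℝ :=
  if ∃ n : ℕ, 1 ≤ n ∧ s = 4 * (4:ℝ) ^ (-(n:ℤ)) then π
  else if ∃ n : ℕ, 1 ≤ n ∧ s = 2 * (4:ℝ) ^ (-(n:ℤ)) then 0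
  else if ∃ n : ℕ, 1 ≤ n ∧
      s ∈ Ioo (2 * (4:ℝ) ^ (-(n:ℤ))) (4 * (4:ℝ) ^ (-(n:ℤ)))
  then γ₁ else γ₂

theorem ex2_tri (m n : ℕ) : m = n ∨ 4 * (4:ℝ) ^ (-(m:ℤ)) ≤ (4:ℝ) ^ (-(n:ℤ)) ∨
    4 * (4:ℝ) ^ (-(n:ℤ)) ≤ (4:ℝ) ^ (-(m:ℤ)) := by
  have key : ∀ m n : ℕ, m < n → 4 * (4:ℝ) ^ (-(n:ℤ)) ≤ (4:ℝ) ^ (-(m:ℤ)) := by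
    intro m n h
    have e : 4 * (4:ℝ) ^ (-(n:ℤ)) = (4:ℝ) ^ (1 + -(n:ℤ)) := by
      rw [zpow_add₀ (by norm_num)]; norm_num
    rw [e]
    exact zpow_le_zpow_right₀ (by norm_num) (by omega)
  rcases lt_trichotomy m n with h | h | h
  · exact Or.inr (Or.inr (key m n h))
  · exact Or.inl h
  · exact Or.inr (Or.inl (key n m h))

theorem ex2_upper (γ₁ γ₂ s : ℝ) (n : ℕ) (hn : 1 ≤ n)
    (hs : s ∈ Ioo (2 * (4:ℝ) ^ (-(n:ℤ))) (4 * (4:ℝ) ^ (-(n:ℤ)))) :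
    gammaEx2 γ₁ γ₂ s = γ₁ := by
  have hp : ∀ k : ℕ, (0:ℝ) < (4:ℝ) ^ (-(k:ℤ)) := fun k => by positivity
  obtain ⟨ha, hb⟩ := hs
  unfold gammaEx2
  rw [if_neg, if_neg, if_pos ⟨n, hn, ha, hb⟩]
  · rintro ⟨m, -, h⟩
    have := hp m
    have := hp n
    rcases ex2_tri m n with rfl | h' | h' <;> linarith
  · rintro ⟨m, -, h⟩
    have := hp m
    have := hp n
    rcases ex2_tri m n with rfl | h' | h' <;> linarith

theorem ex2_lower (γ₁ γ₂ s : ℝ) (n : ℕ)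
    (hs : s ∈ Ioo ((4:ℝ) ^ (-(n:ℤ))) (2 * (4:ℝ) ^ (-(n:ℤ)))) :
    gammaEx2 γ₁ γ₂ s = γ₂ := by
  have hp : ∀ k : ℕ, (0:ℝ) < (4:ℝ) ^ (-(k:ℤ)) := fun k => by positivity
  obtain ⟨ha, hb⟩ := hs
  unfold gammaEx2
  rw [if_neg, if_neg, if_neg]
  · rintro ⟨m, -, h1, h2⟩
    have := hp m
    have := hp n
    rcases ex2_tri m n with rfl | h' | h' <;> linarith
  · rintro ⟨m, -, h⟩
    have := hp m
    have := hp n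
    rcases ex2_tri m n with rfl | h' | h' <;> linarith
  · rintro ⟨m, -, h⟩
    have := hp m
    have := hp n
    rcases ex2_tri m n with rfl | h' | h' <;> linarith

theorem ex2_meas (γ₁ γ₂ : ℝ) : Measurable (gammaEx2 γ₁ γ₂) := by
  unfold gammaEx2
  refine Measurable.ite ?_ measurable_const (Measurable.ite ?_ measurable_const
    (Measurable.ite ?_ measurable_const measurable_const))
  · simp only [ofPred_exists, ofPred_and]
    exact MeasurableSet.iUnion fun n => (MeasurableSet.const _).inter (measurableSet_singleton _)
  · simp only [ofPred_exists, ofPred_and]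
    exact MeasurableSet.iUnion fun n => (MeasurableSet.const _).inter (measurableSet_singleton _)
  · simp only [ofPred_exists, ofPred_and]
    exact MeasurableSet.iUnion fun n => (MeasurableSet.const _).inter measurableSet_Ioo

theorem ex2_int (γ₁ γ₂ u v : ℝ) :
    IntervalIntegrable (fun t => Real.cos (gammaEx2 γ₁ γ₂ t)) volume u v := by
  refine (intervalIntegrable_const (c := (1:ℝ))).mono_fun
    (Real.measurable_cos.comp (ex2_meas γ₁ γ₂)).aestronglyMeasurable ?_
  refine Filter.Eventually.of_forall fun t => ?_
  simpa using Real.abs_cos_le_one _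

theorem ex2_const (f : ℝ → ℝ) (c u v : ℝ) (huv : u ≤ v) (h : ∀ t ∈ Ioo u v, f t = c) :
    ∫ t in u..v, f t = (v - u) * c := by
  rw [intervalIntegral.integral_of_le huv, integral_Ioc_eq_integral_Ioo,
    setIntegral_congr_fun measurableSet_Ioo h]
  simp [huv]

theorem ex2_node (γ₁ γ₂ : ℝ) (n : ℕ) :
    ∫ t in (0:ℝ)..(4:ℝ) ^ (-(n:ℤ)), Real.cos (gammaEx2 γ₁ γ₂ t) =
      (2/3 * Real.cos γ₁ + 1/3 * Real.cos γ₂) * (4:ℝ) ^ (-(n:ℤ)) := by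
  set c := 2/3 * Real.cos γ₁ + 1/3 * Real.cos γ₂ with hc
  set F : ℕ → ℝ := fun n => (∫ t in (0:ℝ)..(4:ℝ) ^ (-(n:ℤ)), Real.cos (gammaEx2 γ₁ γ₂ t))
    - c * (4:ℝ) ^ (-(n:ℤ)) with hF
  have hstep : ∀ n, F (n+1) = F n := by
    intro n
    have e : (4:ℝ) ^ (-(n:ℤ)) = 4 * (4:ℝ) ^ (-((n+1:ℕ):ℤ)) := by
      rw [show -(n:ℤ) = 1 + -((n+1:ℕ):ℤ) by push_cast; ring, zpow_add₀ (by norm_num)]; norm_num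
    simp only [hF]
    rw [e]
    have hq : (0:ℝ) < (4:ℝ) ^ (-((n+1:ℕ):ℤ)) := by positivity
    have h1 := ex2_const (fun t => Real.cos (gammaEx2 γ₁ γ₂ t)) (Real.cos γ₂)
      ((4:ℝ) ^ (-((n+1:ℕ):ℤ))) (2 * (4:ℝ) ^ (-((n+1:ℕ):ℤ))) (by linarith)
      (fun t ht => by simp only [ex2_lower γ₁ γ₂ t (n+1) ht])
    have h2 := ex2_const (fun t => Real.cos (gammaEx2 γ₁ γ₂ t)) (Real.cos γ₁)
      (2 * (4:ℝ) ^ (-((n+1:ℕ):ℤ))) (4 * (4:ℝ) ^ (-((n+1:ℕ):ℤ))) (by linarith)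
      (fun t ht => by simp only [ex2_upper γ₁ γ₂ t (n+1) (by omega) ht])
    rw [← intervalIntegral.integral_add_adjacent_intervals
        (ex2_int γ₁ γ₂ 0 (2 * (4:ℝ) ^ (-((n+1:ℕ):ℤ))))
        (ex2_int γ₁ γ₂ _ (4 * (4:ℝ) ^ (-((n+1:ℕ):ℤ)))),
      ← intervalIntegral.integral_add_adjacent_intervals
        (ex2_int γ₁ γ₂ 0 ((4:ℝ) ^ (-((n+1:ℕ):ℤ))))
        (ex2_int γ₁ γ₂ _ (2 * (4:ℝ) ^ (-((n+1:ℕ):ℤ)))), h1, h2, hc]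
    ring
  have hconst : ∀ k, F k = F n := by
    have h0 : ∀ k, F k = F 0 := by
      intro k
      induction k with
      | zero => rfl
      | succ k ih => rw [hstep, ih]
    intro k
    rw [h0 k, h0 n]
  have hbd : ∀ k, |F k| ≤ (1 + |c|) * (1/4:ℝ) ^ k := by
    intro k
    have e : (4:ℝ) ^ (-(k:ℤ)) = (1/4:ℝ) ^ k := by simp
    have hq : (0:ℝ) < (1/4:ℝ) ^ k := by positivity
    simp only [hF]
    rw [e]
    have h1 := intervalIntegral.norm_integral_le_of_norm_le_const (a := 0) (b := (1/4:ℝ) ^ k)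
      (f := fun t => Real.cos (gammaEx2 γ₁ γ₂ t)) (C := 1)
      (fun t _ => by simpa using Real.abs_cos_le_one _)
    rw [Real.norm_eq_abs, sub_zero, abs_of_pos hq, one_mul] at h1
    refine (abs_sub _ _).trans ?_
    rw [abs_mul, abs_of_pos hq]
    linarith
  have hlim : Tendsto (fun k : ℕ => (1 + |c|) * (1/4:ℝ) ^ k) atTop (𝓝 0) := by
    simpa using (tendsto_pow_atTop_nhds_zero_of_lt_one (r := (1/4:ℝ)) (by norm_num)
      (by norm_num)).const_mul (1 + |c|)
  have : |F n| ≤ 0 := ge_of_tendsto' hlim fun k => by rw [← hconst k]; exact hbd k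
  have := abs_nonpos_iff.mp this
  simp only [hF] at this
  linarith

/-- For the contact angle of Example 2 and any `x ∈ (0,1)`,
`(1/3)cos γ₁ + (2/3)cos γ₂ ≤ (1/x) ∫₀^x cos(γ(t)) dt ≤ (2/3)cos γ₁ + (1/3)cos γ₂`. -/
theorem example2_mean_bounds (γ₁ γ₂ : ℝ) (h₁ : 0 ≤ γ₁) (h₁₂ : γ₁ ≤ γ₂) (h₂ : γ₂ ≤ π)
    (x : ℝ) (hx : x ∈ Ioo (0:ℝ) 1) :
    (1/3) * Real.cos γ₁ + (2/3) * Real.cos γ₂ ≤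
        x⁻¹ * ∫ t in Ioo (0:ℝ) x, Real.cos (gammaEx2 γ₁ γ₂ t) ∧
      x⁻¹ * ∫ t in Ioo (0:ℝ) x, Real.cos (gammaEx2 γ₁ γ₂ t) ≤
        (2/3) * Real.cos γ₁ + (1/3) * Real.cos γ₂ := by
  obtain ⟨hx0, hx1⟩ := hx
  have hab : Real.cos γ₂ ≤ Real.cos γ₁ := Real.cos_le_cos_of_nonneg_of_le_pi h₁ h₂ h₁₂
  obtain ⟨k, hk1, hk2⟩ := exists_nat_pow_near_of_lt_one hx0 hx1.le
    (show (0:ℝ) < 1/4 by norm_num) (by norm_num)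
  have hnode := ex2_node γ₁ γ₂ (k+1)
  have hup := fun s => ex2_upper γ₁ γ₂ s (k+1) (by omega)
  have hlo := fun s => ex2_lower γ₁ γ₂ s (k+1)
  have e : (4:ℝ) ^ (-((k+1:ℕ):ℤ)) = (1/4:ℝ) ^ (k+1) := by
    rw [zpow_neg, zpow_natCast]; simp
  have e2 : (1/4:ℝ) ^ k = 4 * (1/4:ℝ) ^ (k+1) := by rw [pow_succ]; ring
  rw [e] at hnode hup hlo
  rw [e2] at hk2
  have hq : (0:ℝ) < (1/4:ℝ) ^ (k+1) := by positivity
  generalize (1/4:ℝ) ^ (k+1) = q at *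
  rw [← integral_Ioc_eq_integral_Ioo, ← intervalIntegral.integral_of_le hx0.le,
    inv_mul_eq_div, le_div_iff₀ hx0, div_le_iff₀ hx0]
  rw [← intervalIntegral.integral_add_adjacent_intervals
        (ex2_int γ₁ γ₂ 0 q) (ex2_int γ₁ γ₂ _ _), hnode]
  rcases le_total x (2 * q) with h | h
  · rw [ex2_const (fun t => Real.cos (gammaEx2 γ₁ γ₂ t)) (Real.cos γ₂) q x hk1.le
      (fun t ht => by simp only [hlo t ⟨ht.1, ht.2.trans_le h⟩])]
    constructor <;> nlinarith
  · rw [← intervalIntegral.integral_add_adjacent_intervals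
        (ex2_int γ₁ γ₂ q (2 * q)) (ex2_int γ₁ γ₂ _ _),
      ex2_const (fun t => Real.cos (gammaEx2 γ₁ γ₂ t)) (Real.cos γ₂) q (2 * q) (by linarith)
      (fun t ht => by simp only [hlo t ht]),
      ex2_const (fun t => Real.cos (gammaEx2 γ₁ γ₂ t)) (Real.cos γ₁) (2 * q) x h
      (fun t ht => by simp only [hup t ⟨ht.1, ht.2.trans_le hk2⟩])]
    constructor <;> nlinarith
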